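/- Let M be a spacelike surface in ℝ^{3,1} with a canonical normal null direction Z. Then the Levi-Civita connection of M satisfies ∇_{Z^⊤} Z^⊤ = 0, ∇_W Z^⊤ = a W, ∇_{Z^⊤} W = 0 and ∇_W W = −a Z^⊤; in particular the Lie bracket satisfies [Z^⊤, W] = −a W. -/

import Mathlib

noncomputable section

/-- Points of the parameter domain of the surface chart. -/
abbrev Pt : Type := ℝ × ℝ

/-- Vectors of the Minkowski space `ℝ^{3,1}`. -/
abbrev E4 : Type := Fin 4 → ℝ

/-- The Minkowski bilinear form of signature `(+,+,+,-)` on `ℝ⁴`. -/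
def mink (v w : E4) : ℝ := v 0 * w 0 + v 1 * w 1 + v 2 * w 2 - v 3 * w 3

/-- Realization in `ℝ^{3,1}` of a coordinate vector field `X` along the immersion `ψ`. -/
def vecF (ψ : Pt → E4) (X : Pt → Pt) : Pt → E4 := fun p => fderiv ℝ ψ p (X p)

/-- Flat (ambient) derivative of an `ℝ⁴`-valued field along a coordinate vector field. -/
def Dflat (X : Pt → Pt) (V : Pt → E4) : Pt → E4 := fun p => fderiv ℝ V p (X p)

/-- Second fundamental form `B(X,Y) = ∇̄_X Y − ∇_X Y`. -/
def sff (ψ : Pt → E4) (conn : (Pt → Pt) → (Pt → Pt) → Pt → Pt) (X Y : Pt → Pt) : Pt → E4 :=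
  fun p => Dflat X (vecF ψ Y) p - vecF ψ (conn X Y) p

/-- `v` is tangent to the surface at `p`. -/
def isTangentV (ψ : Pt → E4) (p : Pt) (v : E4) : Prop := ∃ w : Pt, fderiv ℝ ψ p w = v

/-- `v` is normal to the surface at `p`. -/
def isNormalV (ψ : Pt → E4) (p : Pt) (v : E4) : Prop := ∀ w : Pt, mink v (fderiv ℝ ψ p w) = 0

/-- Lie bracket of coordinate vector fields on the chart. -/
def lieB (X Y : Pt → Pt) : Pt → Pt := fun p => fderiv ℝ Y p (X p) - fderiv ℝ X p (Y p)

/-- Curvature tensor `R(X,Y)V = ∇_Y∇_X V − ∇_X∇_Y V + ∇_{[X,Y]}V`. -/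
def curvR (conn : (Pt → Pt) → (Pt → Pt) → Pt → Pt) (X Y V : Pt → Pt) : Pt → Pt :=
  fun p => conn Y (conn X V) p - conn X (conn Y V) p + conn (lieB X Y) V p

/-- Normal curvature tensor `R^⊥(X,Y)ν = ∇⊥_Y∇⊥_X ν − ∇⊥_X∇⊥_Y ν + ∇⊥_{[X,Y]}ν`. -/
def curvRperp (nconn : (Pt → Pt) → (Pt → E4) → Pt → E4) (X Y : Pt → Pt) (ν : Pt → E4) :
    Pt → E4 :=
  fun p => nconn Y (nconn X ν) p - nconn X (nconn Y ν) p + nconn (lieB X Y) ν p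

/-- Determinant of four vectors of `ℝ⁴` (the volume form `e₁∧e₂∧e₃∧e₄ ↦ 1`). -/
def det4 (a b c d : E4) : ℝ := Matrix.det (Matrix.of ![a, b, c, d])

/-- A spacelike surface in `ℝ^{3,1}`, given by a chart `ψ : U → ℝ^{3,1}`, endowed with a
canonical normal null direction with respect to the constant unit spacelike vector `Z`,
together with all the associated geometric data: the Levi-Civita connection `conn`,
the normal connection `nconn`, the tangent part `Z^⊤` (coordinates `ZT`), the oriented
orthonormal completion `W` (coordinates `Wc`), the shape operator `shA = A_{Z^⊥}`,
the 1-form `β` with `B(X,Z^⊤) = β(X)Z^⊥`, and the lightlike normal field `W'` with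
`⟨Z^⊥,W'⟩ = 1`.  Each piece of data is characterized by its defining property. -/
structure CNND where
  U : Set Pt
  hUopen : IsOpen U
  ψ : Pt → E4
  hψ : ContDiffOn ℝ (⊤ : ℕ∞) ψ U
  himm : ∀ p ∈ U, ∀ v : Pt, fderiv ℝ ψ p v = 0 → v = 0
  hspacelike : ∀ p ∈ U, ∀ v : Pt, v ≠ 0 → 0 < mink (fderiv ℝ ψ p v) (fderiv ℝ ψ p v)
  /-- Levi-Civita connection of the induced metric, as the tangent part of the flat one. -/
  conn : (Pt → Pt) → (Pt → Pt) → Pt → Pt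
  hconn : ∀ X Y, ∀ p ∈ U, DifferentiableAt ℝ (vecF ψ Y) p → isNormalV ψ p (sff ψ conn X Y p)
  hconnSmooth : ∀ X Y, ContDiffOn ℝ (⊤ : ℕ∞) X U → ContDiffOn ℝ (⊤ : ℕ∞) Y U → ContDiffOn ℝ (⊤ : ℕ∞) (conn X Y) U
  /-- Normal connection: the normal part of the flat derivative of a normal field. -/
  nconn : (Pt → Pt) → (Pt → E4) → Pt → E4
  hnconn : ∀ X ν, ∀ p ∈ U, (∀ q ∈ U, isNormalV ψ q (ν q)) → DifferentiableAt ℝ ν p →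
    isNormalV ψ p (nconn X ν p) ∧ isTangentV ψ p (Dflat X ν p - nconn X ν p)
  hnconnSmooth : ∀ X ν, ContDiffOn ℝ (⊤ : ℕ∞) X U → (∀ q ∈ U, isNormalV ψ q (ν q)) →
    ContDiffOn ℝ (⊤ : ℕ∞) ν U → ContDiffOn ℝ (⊤ : ℕ∞) (nconn X ν) U
  /-- The parallel (constant) vector field `Z`, a unit spacelike vector. -/
  Z : E4
  hZunit : mink Z Z = 1
  /-- Coordinates of the tangent part `Z^⊤` of `Z`; `Z^⊥ = Z − Z^⊤` is normal. -/
  ZT : Pt → Pt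
  hZTsmooth : ContDiffOn ℝ (⊤ : ℕ∞) ZT U
  hZTtangentpart : ∀ p ∈ U, isNormalV ψ p (Z - fderiv ℝ ψ p (ZT p))
  /-- canonical normal null direction: `Z^⊥` is lightlike … -/
  hZperpNull : ∀ p ∈ U, mink (Z - fderiv ℝ ψ p (ZT p)) (Z - fderiv ℝ ψ p (ZT p)) = 0
  /-- … and nowhere zero. -/
  hZperpNe : ∀ p ∈ U, Z - fderiv ℝ ψ p (ZT p) ≠ 0
  /-- Coordinates of the unit tangent field `W` orthogonal to `Z^⊤`, positively oriented. -/
  Wc : Pt → Pt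
  hWsmooth : ContDiffOn ℝ (⊤ : ℕ∞) Wc U
  hWunit : ∀ p ∈ U, mink (fderiv ℝ ψ p (Wc p)) (fderiv ℝ ψ p (Wc p)) = 1
  hWorth : ∀ p ∈ U, mink (fderiv ℝ ψ p (ZT p)) (fderiv ℝ ψ p (Wc p)) = 0
  hWorient : ∀ p ∈ U, 0 < (ZT p).1 * (Wc p).2 - (ZT p).2 * (Wc p).1
  /-- The shape operator `A_{Z^⊥}`: `⟨A_{Z^⊥}X, Y⟩ = ⟨B(X,Y), Z^⊥⟩`. -/
  shA : (Pt → Pt) → Pt → Pt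
  hshA : ∀ X Y, ∀ p ∈ U, DifferentiableAt ℝ (vecF ψ Y) p →
    mink (fderiv ℝ ψ p (shA X p)) (fderiv ℝ ψ p (Y p)) =
      mink (sff ψ conn X Y p) (Z - fderiv ℝ ψ p (ZT p))
  /-- The 1-form `β` with `B(X, Z^⊤) = β(X) Z^⊥`. -/
  beta : Pt → Pt → ℝ
  hbeta : ∀ X, ∀ p ∈ U, sff ψ conn X ZT p = beta p (X p) • (Z - fderiv ℝ ψ p (ZT p))
  /-- The lightlike normal field `W'` with `⟨Z^⊥, W'⟩ = 1`, such that
  `(Z^⊤, W, (Z^⊥+W')/√2, (Z^⊥−W')/√2)` is a positively oriented orthonormal frame. -/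
  Wp : Pt → E4
  hWpNormal : ∀ p ∈ U, isNormalV ψ p (Wp p)
  hWpNull : ∀ p ∈ U, mink (Wp p) (Wp p) = 0
  hWpPair : ∀ p ∈ U, mink (Z - fderiv ℝ ψ p (ZT p)) (Wp p) = 1
  hWpOrient : ∀ p ∈ U, 0 < det4 (fderiv ℝ ψ p (ZT p)) (fderiv ℝ ψ p (Wc p))
    ((Real.sqrt 2)⁻¹ • ((Z - fderiv ℝ ψ p (ZT p)) + Wp p))
    ((Real.sqrt 2)⁻¹ • ((Z - fderiv ℝ ψ p (ZT p)) - Wp p))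

namespace CNND

variable (S : CNND)

/-- The normal part `Z^⊥` of `Z` along the surface. -/
def Zperp : Pt → E4 := fun p => S.Z - fderiv ℝ S.ψ p (S.ZT p)

/-- The second fundamental form of the surface. -/
def B : (Pt → Pt) → (Pt → Pt) → Pt → E4 := sff S.ψ S.conn

/-- The function `a = α(W) = ⟨B(W,W), Z^⊥⟩`. -/
def afun : Pt → ℝ := fun p => mink (S.B S.Wc S.Wc p) (S.Zperp p)

/-- The 1-form `α(X) = ⟨B(X,W), Z^⊥⟩`. -/
def alphaF (X : Pt → Pt) : Pt → ℝ := fun p => mink (S.B X S.Wc p) (S.Zperp p)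

/-- The mean curvature vector `H⃗ = (1/2)(B(Z^⊤,Z^⊤) + B(W,W))`. -/
def Hvec : Pt → E4 := fun p => (1 / 2 : ℝ) • (S.B S.ZT S.ZT p + S.B S.Wc S.Wc p)

/-- The Gauss curvature `K = ⟨R(Z^⊤,W)Z^⊤, W⟩`. -/
def Kfun : Pt → ℝ := fun p =>
  mink (fderiv ℝ S.ψ p (curvR S.conn S.ZT S.Wc S.ZT p)) (fderiv ℝ S.ψ p (S.Wc p))

/-- The normal curvature `K_N = ⟨R^⊥(Z^⊤,W)Z^⊥, W'⟩`. -/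
def KNfun : Pt → ℝ := fun p => mink (curvRperp S.nconn S.ZT S.Wc S.Zperp p) (S.Wp p)

end CNND

/-- The wedge `v ∧ w` of two vectors of `ℝ⁴`, as an antisymmetric matrix (bivector). -/
def wedge2 (v w : E4) : Fin 4 → Fin 4 → ℝ := fun i j => v i * w j - v j * w i

/-- The Gauss map `G = Z^⊤ ∧ W : M → Λ²ℝ^{3,1}`. -/
def CNND.Gmap (S : CNND) : Pt → Fin 4 → Fin 4 → ℝ :=
  fun p => wedge2 (fderiv ℝ S.ψ p (S.ZT p)) (fderiv ℝ S.ψ p (S.Wc p))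

/-- The signs of the Minkowski metric. -/
def epsM : Fin 4 → ℝ := fun i => if i = 3 then -1 else 1

/-- The induced (signature `(3,3)`) inner product on bivectors of `ℝ^{3,1}`:
`⟨v∧w, v'∧w'⟩ = ⟨v,v'⟩⟨w,w'⟩ − ⟨v,w'⟩⟨w,v'⟩`. -/
def binner (η η' : Fin 4 → Fin 4 → ℝ) : ℝ :=
  (1 / 2) * ∑ i : Fin 4, ∑ j : Fin 4, epsM i * epsM j * η i j * η' i j

/-- The wedge product `Λ²ℝ^{3,1} × Λ²ℝ^{3,1} → Λ⁴ℝ^{3,1} ≅ ℝ`, normalized so that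
`(v∧w)∧(v'∧w') = det(v,w,v',w')`. -/
def bwedge (η η' : Fin 4 → Fin 4 → ℝ) : ℝ :=
  (1 / 4) * ∑ σ : Equiv.Perm (Fin 4),
    ((Equiv.Perm.sign σ : ℤ) : ℝ) * η (σ 0) (σ 1) * η' (σ 2) (σ 3)

/-- The `ℂ`-bilinear form `H(η,η') = ⟨η,η'⟩ + i η∧η'` on bivectors, where `i = −⋆`. -/
def HformC (η η' : Fin 4 → Fin 4 → ℝ) : ℂ :=
  (binner η η' : ℝ) + (bwedge η η' : ℝ) * Complex.I

/-- The quadratic form `δ(u) = dG(u) ∧ dG(u)` whose zero directions are the asymptotic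
directions. -/
def CNND.deltaQ (S : CNND) (p : Pt) (u : Pt) : ℝ :=
  bwedge (fderiv ℝ S.Gmap p u) (fderiv ℝ S.Gmap p u)

theorem mink_comm (v w : E4) : mink v w = mink w v := by
  simp only [mink]; ring

theorem mink_add_left (u v w : E4) : mink (u + v) w = mink u w + mink v w := by
  simp only [mink, Pi.add_apply]; ring

theorem mink_sub_left (u v w : E4) : mink (u - v) w = mink u w - mink v w := by
  simp only [mink, Pi.sub_apply]; ring

theorem mink_neg_left (v w : E4) : mink (-v) w = -mink v w := by
  simp only [mink, Pi.neg_apply]; ring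

theorem mink_smul_left (c : ℝ) (v w : E4) : mink (c • v) w = c * mink v w := by
  simp only [mink, Pi.smul_apply, smul_eq_mul]; ring

/-- Metric compatibility of the flat derivative, for fields with locally constant product. -/
theorem mink_Dflat_add_of_const {U : Set Pt} (hU : IsOpen U) {V W : Pt → E4} {c : ℝ}
    (hc : ∀ q ∈ U, mink (V q) (W q) = c) {p : Pt} (hp : p ∈ U)
    (hV : DifferentiableAt ℝ V p) (hW : DifferentiableAt ℝ W p) (X : Pt → Pt) :
    mink (Dflat X V p) (W p) + mink (V p) (Dflat X W p) = 0 := by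
  have hVi := fun i => hasFDerivAt_pi'.1 hV.hasFDerivAt i
  have hWi := fun i => hasFDerivAt_pi'.1 hW.hasFDerivAt i
  have hprod := ((((hVi 0).mul (hWi 0)).add ((hVi 1).mul (hWi 1))).add
    ((hVi 2).mul (hWi 2))).sub ((hVi 3).mul (hWi 3))
  have hconst : HasFDerivAt (fun q => mink (V q) (W q)) (0 : Pt →L[ℝ] ℝ) p :=
    (hasFDerivAt_const c p).congr_of_eventuallyEq
      (Filter.mem_of_superset (hU.mem_nhds hp) hc)
  have h := DFunLike.congr_fun (hprod.unique hconst) (X p)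
  simp at h
  simp only [mink, Dflat]
  linarith

/-- In an orthonormal frame of the plane, a vector is determined by its two components. -/
theorem eq_smul_add_smul_of_mink (L : Pt →L[ℝ] E4) {t w : Pt}
    (htt : mink (L t) (L t) = 1) (hww : mink (L w) (L w) = 1) (htw : mink (L t) (L w) = 0)
    (hdet : 0 < t.1 * w.2 - t.2 * w.1) (u : Pt) :
    u = mink (L u) (L t) • t + mink (L u) (L w) • w := by
  have hd := hdet.ne'
  obtain ⟨c, d, rfl⟩ : ∃ c d : ℝ, u = c • t + d • w := by
    refine ⟨(u.1 * w.2 - u.2 * w.1) / (t.1 * w.2 - t.2 * w.1),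
      (t.1 * u.2 - t.2 * u.1) / (t.1 * w.2 - t.2 * w.1), ?_⟩
    ext <;> simp only [Prod.fst_add, Prod.snd_add, Prod.smul_fst, Prod.smul_snd, smul_eq_mul] <;>
      rw [div_mul_eq_mul_div, div_mul_eq_mul_div, ← add_div, eq_div_iff hd] <;> ring
  have hwt : mink (L w) (L t) = 0 := by rw [mink_comm, htw]
  simp only [map_add, map_smul, mink_add_left, mink_smul_left, htt, hww, htw, hwt]
  simp

namespace CNND

variable (S : CNND) {p : Pt}

theorem contDiffAt_ψ (hp : p ∈ S.U) : ContDiffAt ℝ 2 S.ψ p :=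
  (S.hψ.contDiffAt (S.hUopen.mem_nhds hp)).of_le (WithTop.coe_le_coe.2 (le_top : (2 : ℕ∞) ≤ ⊤))

theorem differentiableAt_fderiv (hp : p ∈ S.U) : DifferentiableAt ℝ (fderiv ℝ S.ψ) p :=
  ((S.contDiffAt_ψ hp).fderiv_right (m := 1) (by norm_num)).differentiableAt (by norm_num)

theorem differentiableAt_of_smooth {Y : Pt → Pt} (hY : ContDiffOn ℝ (⊤ : ℕ∞) Y S.U)
    (hp : p ∈ S.U) : DifferentiableAt ℝ Y p :=
  (hY.contDiffAt (S.hUopen.mem_nhds hp)).differentiableAt (by simp)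

theorem differentiableAt_vecF {Y : Pt → Pt} (hY : ContDiffOn ℝ (⊤ : ℕ∞) Y S.U)
    (hp : p ∈ S.U) : DifferentiableAt ℝ (vecF S.ψ Y) p :=
  (S.differentiableAt_fderiv hp).clm_apply (S.differentiableAt_of_smooth hY hp)

/-- The flat connection is torsion-free along the surface. -/
theorem fderiv_lieB {X Y : Pt → Pt} (hX : ContDiffOn ℝ (⊤ : ℕ∞) X S.U)
    (hY : ContDiffOn ℝ (⊤ : ℕ∞) Y S.U) (hp : p ∈ S.U) :
    fderiv ℝ S.ψ p (lieB X Y p) = Dflat X (vecF S.ψ Y) p - Dflat Y (vecF S.ψ X) p := by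
  have hsymm : IsSymmSndFDerivAt ℝ S.ψ p :=
    (S.contDiffAt_ψ hp).isSymmSndFDerivAt (by simp)
  have hD := S.differentiableAt_fderiv hp
  simp only [Dflat, lieB]
  unfold vecF
  rw [fderiv_clm_apply hD (S.differentiableAt_of_smooth hX hp),
    fderiv_clm_apply hD (S.differentiableAt_of_smooth hY hp)]
  simp [hsymm.eq (X p) (Y p)]

/-- The covariant derivative and the flat derivative have the same tangential components. -/
theorem mink_fderiv_conn (X : Pt → Pt) {Y : Pt → Pt} (hY : ContDiffOn ℝ (⊤ : ℕ∞) Y S.U)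
    (hp : p ∈ S.U) (u : Pt) :
    mink (fderiv ℝ S.ψ p (S.conn X Y p)) (fderiv ℝ S.ψ p u) =
      mink (Dflat X (vecF S.ψ Y) p) (fderiv ℝ S.ψ p u) := by
  have h := S.hconn X Y p hp (S.differentiableAt_vecF hY hp) u
  rw [sff, mink_sub_left] at h
  exact (sub_eq_zero.1 h).symm

theorem mink_fderiv_Zperp (hp : p ∈ S.U) (u : Pt) :
    mink (fderiv ℝ S.ψ p u) (S.Zperp p) = 0 := by
  rw [mink_comm]; exact S.hZTtangentpart p hp u

theorem mink_B_Zperp (X Y : Pt → Pt) (hp : p ∈ S.U) :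
    mink (S.B X Y p) (S.Zperp p) = mink (Dflat X (vecF S.ψ Y) p) (S.Zperp p) := by
  rw [B, sff, mink_sub_left, vecF, S.mink_fderiv_Zperp hp, sub_zero]

theorem mink_ZT_ZT (hp : p ∈ S.U) :
    mink (fderiv ℝ S.ψ p (S.ZT p)) (fderiv ℝ S.ψ p (S.ZT p)) = 1 := by
  have h1 := S.hZTtangentpart p hp (S.ZT p)
  have h2 := S.hZperpNull p hp
  have h3 := S.hZunit
  simp only [mink, Pi.sub_apply] at *
  linarith

theorem eq_frame_expansion (hp : p ∈ S.U) (u : Pt) :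
    u = mink (fderiv ℝ S.ψ p u) (fderiv ℝ S.ψ p (S.ZT p)) • S.ZT p +
      mink (fderiv ℝ S.ψ p u) (fderiv ℝ S.ψ p (S.Wc p)) • S.Wc p :=
  eq_smul_add_smul_of_mink _ (S.mink_ZT_ZT hp) (S.hWunit p hp) (S.hWorth p hp)
    (S.hWorient p hp) u

/-- `⟨∇̄_X Z^⊤, W⟩ = ⟨B(X,W), Z^⊥⟩`, because `Z` is parallel. -/
theorem mink_Dflat_ZT_Wc (X : Pt → Pt) (hp : p ∈ S.U) :
    mink (Dflat X (vecF S.ψ S.ZT) p) (fderiv ℝ S.ψ p (S.Wc p)) = S.alphaF X p := by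
  have hT := S.differentiableAt_vecF S.hZTsmooth hp
  have hW := S.differentiableAt_vecF S.hWsmooth hp
  have h := mink_Dflat_add_of_const S.hUopen (V := S.Zperp) (W := vecF S.ψ S.Wc) (c := 0)
    (fun q hq => S.hZTtangentpart q hq (S.Wc q)) hp (hT.const_sub S.Z) hW X
  have hN : Dflat X S.Zperp p = -Dflat X (vecF S.ψ S.ZT) p := by
    have : fderiv ℝ S.Zperp p = -fderiv ℝ (vecF S.ψ S.ZT) p := fderiv_const_sub S.Z
    simp [Dflat, this]
  rw [hN, mink_neg_left, mink_comm (S.Zperp p)] at h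
  rw [alphaF, S.mink_B_Zperp X S.Wc hp]
  change mink _ (vecF S.ψ S.Wc p) = _
  linarith

theorem conn_ZT (X : Pt → Pt) (hp : p ∈ S.U) :
    S.conn X S.ZT p = S.alphaF X p • S.Wc p := by
  have hT := S.differentiableAt_vecF S.hZTsmooth hp
  have h : mink (Dflat X (vecF S.ψ S.ZT) p) (fderiv ℝ S.ψ p (S.ZT p)) +
      mink (fderiv ℝ S.ψ p (S.ZT p)) (Dflat X (vecF S.ψ S.ZT) p) = 0 :=
    mink_Dflat_add_of_const S.hUopen (fun q hq => S.mink_ZT_ZT hq) hp hT hT X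
  rw [mink_comm (fderiv ℝ S.ψ p (S.ZT p))] at h
  have h0 : mink (Dflat X (vecF S.ψ S.ZT) p) (fderiv ℝ S.ψ p (S.ZT p)) = 0 := by
    linarith
  rw [S.eq_frame_expansion hp (S.conn X S.ZT p), S.mink_fderiv_conn X S.hZTsmooth hp,
    S.mink_fderiv_conn X S.hZTsmooth hp, h0, S.mink_Dflat_ZT_Wc X hp, zero_smul, zero_add]

theorem conn_Wc (X : Pt → Pt) (hp : p ∈ S.U) :
    S.conn X S.Wc p = (-S.alphaF X p) • S.ZT p := by
  have hT := S.differentiableAt_vecF S.hZTsmooth hp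
  have hW := S.differentiableAt_vecF S.hWsmooth hp
  have h : mink (Dflat X (vecF S.ψ S.Wc) p) (fderiv ℝ S.ψ p (S.Wc p)) +
      mink (fderiv ℝ S.ψ p (S.Wc p)) (Dflat X (vecF S.ψ S.Wc) p) = 0 :=
    mink_Dflat_add_of_const S.hUopen S.hWunit hp hW hW X
  rw [mink_comm (fderiv ℝ S.ψ p (S.Wc p))] at h
  have h0 : mink (Dflat X (vecF S.ψ S.Wc) p) (fderiv ℝ S.ψ p (S.Wc p)) = 0 := by
    linarith
  have h' : mink (Dflat X (vecF S.ψ S.ZT) p) (fderiv ℝ S.ψ p (S.Wc p)) +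
      mink (fderiv ℝ S.ψ p (S.ZT p)) (Dflat X (vecF S.ψ S.Wc) p) = 0 :=
    mink_Dflat_add_of_const S.hUopen S.hWorth hp hT hW X
  rw [mink_comm (fderiv ℝ S.ψ p (S.ZT p))] at h'
  have h1 : mink (Dflat X (vecF S.ψ S.Wc) p) (fderiv ℝ S.ψ p (S.ZT p)) = -S.alphaF X p := by
    rw [← S.mink_Dflat_ZT_Wc X hp]
    linarith
  rw [S.eq_frame_expansion hp (S.conn X S.Wc p), S.mink_fderiv_conn X S.hWsmooth hp,
    S.mink_fderiv_conn X S.hWsmooth hp, h0, h1, zero_smul, add_zero]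

/-- `α(Z^⊤) = ⟨B(W,Z^⊤), Z^⊥⟩` vanishes, as `B(W,Z^⊤)` is a multiple of the null field `Z^⊥`. -/
theorem alphaF_ZT (hp : p ∈ S.U) : S.alphaF S.ZT p = 0 := by
  have hbr := congrArg (mink · (S.Zperp p)) (S.fderiv_lieB S.hZTsmooth S.hWsmooth hp)
  simp only [S.mink_fderiv_Zperp hp, mink_sub_left] at hbr
  have hB : mink (S.B S.Wc S.ZT p) (S.Zperp p) = 0 := by
    rw [B, S.hbeta S.Wc p hp, mink_smul_left]
    exact mul_eq_zero_of_right _ (S.hZperpNull p hp)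
  rw [S.mink_B_Zperp _ _ hp] at hB
  rw [alphaF, S.mink_B_Zperp _ _ hp]
  linarith

/-- The Levi-Civita connection is torsion-free. -/
theorem lieB_eq_conn_sub {X Y : Pt → Pt} (hX : ContDiffOn ℝ (⊤ : ℕ∞) X S.U)
    (hY : ContDiffOn ℝ (⊤ : ℕ∞) Y S.U) (hp : p ∈ S.U) :
    lieB X Y p = S.conn X Y p - S.conn Y X p := by
  have key : ∀ u, mink (fderiv ℝ S.ψ p (lieB X Y p)) (fderiv ℝ S.ψ p u) =
      mink (fderiv ℝ S.ψ p (S.conn X Y p - S.conn Y X p)) (fderiv ℝ S.ψ p u) := fun u => by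
    rw [S.fderiv_lieB hX hY hp, map_sub, mink_sub_left, mink_sub_left,
      S.mink_fderiv_conn X hY hp, S.mink_fderiv_conn Y hX hp]
  rw [S.eq_frame_expansion hp (lieB X Y p), key, key, ← S.eq_frame_expansion hp]

end CNND

/-- The Levi-Civita connection of `M` satisfies `∇_{Z^⊤}Z^⊤ = 0`,
`∇_W Z^⊤ = aW`, `∇_{Z^⊤}W = 0` and `∇_W W = −aZ^⊤`; in particular `[Z^⊤, W] = −aW`. -/
theorem cnnd_levi_civita_frame_equations (S : CNND) :
    ∀ p ∈ S.U,
      S.conn S.ZT S.ZT p = 0 ∧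
      S.conn S.Wc S.ZT p = S.afun p • S.Wc p ∧
      S.conn S.ZT S.Wc p = 0 ∧
      S.conn S.Wc S.Wc p = (-S.afun p) • S.ZT p ∧
      lieB S.ZT S.Wc p = (-S.afun p) • S.Wc p := by
  intro p hp
  have hT : S.conn S.ZT S.ZT p = 0 := by rw [S.conn_ZT _ hp, S.alphaF_ZT hp, zero_smul]
  have hWT : S.conn S.Wc S.ZT p = S.afun p • S.Wc p := S.conn_ZT S.Wc hp
  have hTW : S.conn S.ZT S.Wc p = 0 := by
    rw [S.conn_Wc _ hp, S.alphaF_ZT hp, neg_zero, zero_smul]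
  refine ⟨hT, hWT, hTW, S.conn_Wc S.Wc hp, ?_⟩
  rw [S.lieB_eq_conn_sub S.hZTsmooth S.hWsmooth hp, hTW, hWT, zero_sub, neg_smul]

end
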